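/- Let $G$ be a group, $k$ an algebraically closed field, and $V$, $W$ finite-dimensional irreducible $k$-linear representations of $G$. Let $\chi$ be a one-dimensional representation of $G$. Then $\dim_k \mathrm{Hom}_{k[G]}(\chi, V \otimes W) \leq 1$; equivalently, $\chi \oplus \chi$ cannot occur as a subrepresentation of $V \otimes W$. -/

import Mathlib

open CategoryTheory MonoidalCategory

section LinearAlgebra

variable {k V W : Type*} [Field k] [AddCommGroup V] [Module k V] [AddCommGroup W] [Module k W]

/-- A tensor `t` in `V ⊗ W`, viewed as the linear map `φ ↦ (φ ⊗ id) t` from the dual of `V`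
to `W`. -/
noncomputable def tensorToDualHom : TensorProduct k V W →ₗ[k] Module.Dual k V →ₗ[k] W :=
  dualTensorHom k (Module.Dual k V) W ∘ₗ (Module.Dual.eval k V).rTensor W

@[simp]
lemma tensorToDualHom_tmul (v : V) (w : W) (φ : Module.Dual k V) :
    tensorToDualHom (TensorProduct.tmul k v w) φ = φ v • w := by
  simp [tensorToDualHom]

lemma tensorToDualHom_injective [FiniteDimensional k V] :
    Function.Injective (tensorToDualHom : TensorProduct k V W →ₗ[k] Module.Dual k V →ₗ[k] W) := by
  have h₁ : Function.Injective ((Module.Dual.eval k V).rTensor W) :=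
    ((Module.evalEquiv k V).rTensor W).injective
  have h₂ : Function.Injective (dualTensorHom k (Module.Dual k V) W) :=
    (dualTensorHomEquiv k (Module.Dual k V) W).injective
  exact h₂.comp h₁

end LinearAlgebra

namespace Representation

variable {k G V W : Type*} [Field k] [Group G] [AddCommGroup V] [Module k V]
  [AddCommGroup W] [Module k W] {ρ : Representation k G V} {σ : Representation k G W}

lemma apply_tensorToDualHom (ρ : Representation k G V) (σ : Representation k G W) (g : G)
    (t : TensorProduct k V W) (φ : Module.Dual k V) :
    σ g (tensorToDualHom t φ) =
      tensorToDualHom (TensorProduct.map (ρ g) (σ g) t) (φ ∘ₗ ρ g⁻¹) := by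
  induction t with
  | zero => simp
  | tmul v w => simp
  | add x y hx hy => simp [hx, hy]

lemma tensorToDualHom_surjective_of_semiinvariant [FiniteDimensional k V] [IsIrreducible σ]
    {a : G → k} {t : TensorProduct k V W}
    (ht : ∀ g, TensorProduct.map (ρ g) (σ g) t = a g • t) (ht₀ : t ≠ 0) :
    Function.Surjective (tensorToDualHom t) := by
  let N : Subrepresentation σ :=
    { toSubmodule := (tensorToDualHom t).range
      apply_mem_toSubmodule := by
        rintro g _ ⟨φ, rfl⟩
        rw [apply_tensorToDualHom ρ, ht, map_smul, LinearMap.smul_apply]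
        exact Submodule.smul_mem _ _ ⟨_, rfl⟩ }
  rcases eq_bot_or_eq_top N with h | h
  · have h' : (tensorToDualHom t).range = ⊥ := congrArg Subrepresentation.toSubmodule h
    exact absurd (tensorToDualHom_injective
      ((LinearMap.range_eq_bot.mp h').trans (map_zero _).symm)) ht₀
  · exact LinearMap.range_eq_top.mp (congrArg Subrepresentation.toSubmodule h)

lemma finrank_le_of_semiinvariant [FiniteDimensional k W] [IsIrreducible ρ]
    {a : G → k} {t : TensorProduct k V W}
    (ht : ∀ g, TensorProduct.map (ρ g) (σ g) t = a g • t) (ht₀ : t ≠ 0) :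
    Module.finrank k V ≤ Module.finrank k W := by
  have hcomm : ∀ g, TensorProduct.map (σ g) (ρ g) (_root_.TensorProduct.comm k V W t) =
      a g • _root_.TensorProduct.comm k V W t := fun g ↦ by
    rw [← map_smul, ← ht, TensorProduct.map_comm]
  have hsurj := tensorToDualHom_surjective_of_semiinvariant hcomm (by simpa using ht₀)
  simpa [Subspace.dual_finrank_eq] using LinearMap.finrank_le_finrank_of_surjective hsurj

variable [FiniteDimensional k V] [FiniteDimensional k W] [IsIrreducible ρ] [IsIrreducible σ]

lemma tensorToDualHom_bijective_of_semiinvariant {a : G → k} {t : TensorProduct k V W}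
    (ht : ∀ g, TensorProduct.map (ρ g) (σ g) t = a g • t) (ht₀ : t ≠ 0) :
    Function.Bijective (tensorToDualHom t) := by
  have hsurj := tensorToDualHom_surjective_of_semiinvariant ht ht₀
  have hle := LinearMap.finrank_le_finrank_of_surjective hsurj
  rw [Subspace.dual_finrank_eq] at hle
  have heq : Module.finrank k (Module.Dual k V) = Module.finrank k W :=
    Subspace.dual_finrank_eq.trans ((finrank_le_of_semiinvariant ht ht₀).antisymm hle)
  exact ⟨(LinearMap.injective_iff_surjective_of_finrank_eq_finrank heq).mpr hsurj, hsurj⟩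

/-- Semi-invariant tensors of a given weight in the tensor product of two irreducible
representations are proportional. -/
lemma exists_smul_eq_of_semiinvariant [IsAlgClosed k] {a : G → k} {s t : TensorProduct k V W}
    (hs : ∀ g, TensorProduct.map (ρ g) (σ g) s = a g • s)
    (ht : ∀ g, TensorProduct.map (ρ g) (σ g) t = a g • t) (ht₀ : t ≠ 0) :
    ∃ c : k, c • t = s := by
  let e := LinearEquiv.ofBijective _ (tensorToDualHom_bijective_of_semiinvariant ht ht₀)
  have : Nontrivial W := by
    by_contra h
    rw [not_nontrivial_iff_subsingleton] at h
    exact ht₀ (Subsingleton.elim _ _)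
  obtain ⟨c, hc⟩ := Module.End.exists_eigenvalue (tensorToDualHom s ∘ₗ e.symm.toLinearMap)
  obtain ⟨w, hw⟩ := hc.exists_hasEigenvector
  have hse : tensorToDualHom s (e.symm w) = c • w := hw.apply_eq_smul
  have hte : tensorToDualHom t (e.symm w) = w := e.apply_symm_apply w
  refine ⟨c, ?_⟩
  by_contra hne
  have hinj := (tensorToDualHom_bijective_of_semiinvariant (ρ := ρ) (σ := σ) (a := a)
    (t := s - c • t) (fun g ↦ by rw [map_sub, map_smul, hs, ht, smul_sub, smul_comm])
    (sub_ne_zero.mpr (Ne.symm hne))).injective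
  have hzero : e.symm w = 0 := hinj (by simp [hse, hte])
  exact hw.2 (e.symm.map_eq_zero_iff.mp hzero)

end Representation

namespace FDRep

universe u v

variable {k : Type u} {G : Type v} [Field k] [Group G]

/-- The inclusion of a subrepresentation, as a morphism. -/
noncomputable def subrepresentationι (V : FDRep k G)
    (N : Subrepresentation (A := k) (G := G) (W := V) V.ρ) :
    FDRep.of N.toRepresentation ⟶ V where
  hom := InducedCategory.homMk (ModuleCat.ofHom N.toSubmodule.subtype)
  comm _ := rfl

lemma hom_ρ_apply {V W : FDRep k G} (f : V ⟶ W) (g : G) (v : V) :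
    f.hom.hom.hom (V.ρ g v) = W.ρ g (f.hom.hom.hom v) :=
  ConcreteCategory.congr_hom (f.comm g) v

lemma tensor_ρ (V W : FDRep k G) (g : G) :
    (V ⊗ W).ρ g = TensorProduct.map (V.ρ g) (W.ρ g) := rfl

lemma isIrreducible_of_simple (V : FDRep k G) [Simple V] :
    Representation.IsIrreducible (k := k) (G := G) (V := V) V.ρ := by
  have hom_injective {X Y : FDRep k G} {f f' : X ⟶ Y} (h : f.hom.hom.hom = f'.hom.hom.hom) :
      f = f' := by
    ext x
    exact LinearMap.congr_fun h x
  have : Nontrivial (Subrepresentation (A := k) (G := G) (W := V) V.ρ) := by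
    refine ⟨⊥, ⊤, fun h ↦ id_nonzero V (hom_injective ?_)⟩
    ext v
    have hv : v ∈ (⊥ : Subrepresentation (A := k) (G := G) (W := V) V.ρ).toSubmodule := by
      rw [h]; exact Submodule.mem_top
    exact (Submodule.mem_bot k).mp hv
  refine ⟨fun N ↦ ?_⟩
  have hmono : Mono (V.subrepresentationι N) := ⟨fun f f' h ↦ hom_injective <| by
    ext x
    exact congrArg (fun F ↦ F.hom.hom.hom x) h⟩
  by_cases h : V.subrepresentationι N = 0
  · left
    apply Subrepresentation.toSubmodule_injective
    refine (Submodule.eq_bot_iff _).mpr fun v hv ↦ ?_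
    exact congrArg (fun F ↦ F.hom.hom.hom (⟨v, hv⟩ : N.toSubmodule)) h
  · right
    have := isIso_of_mono_of_nonzero h
    apply Subrepresentation.toSubmodule_injective
    refine Submodule.eq_top_iff'.mpr fun v ↦ ?_
    have hv := congrArg (fun F ↦ F.hom.hom.hom v) (IsIso.inv_hom_id (V.subrepresentationι N))
    have hv' : ((inv (V.subrepresentationι N)).hom.hom.hom v : N.toSubmodule).1 = v := hv
    rw [← hv']
    exact Subtype.property _

end FDRep

/-- for irreducible finite-dimensional representations `V`, `W` of a group
`G` over an algebraically closed field `k` and a one-dimensional representation `χ`,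
the space `Hom(χ, V ⊗ W)` is at most one-dimensional; equivalently `χ ⊕ χ` does not
embed into `V ⊗ W`. -/
theorem stmt_2 (k G : Type) [Field k] [IsAlgClosed k] [Group G]
    (V W χ : FDRep k G) [Simple V] [Simple W]
    (hχ : Module.finrank k χ = 1) :
    Module.finrank k (χ ⟶ V ⊗ W) ≤ 1 ∧
      ∀ f₁ f₂ : (χ ⟶ V ⊗ W), ¬ LinearIndependent k ![f₁, f₂] := by
  have hle : Module.finrank k (χ ⟶ V ⊗ W) ≤ 1 := by
    have := V.isIrreducible_of_simple
    have := W.isIrreducible_of_simple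
    obtain ⟨e, -, he⟩ := finrank_eq_one_iff'.mp hχ
    choose a ha using fun g ↦ he (χ.ρ g e)
    have hom_ext {f f' : χ ⟶ V ⊗ W} (h : f.hom.hom.hom e = f'.hom.hom.hom e) : f = f' := by
      ext x
      obtain ⟨c, rfl⟩ := he x
      change f.hom.hom.hom (c • e) = f'.hom.hom.hom (c • e)
      rw [map_smul, map_smul, h]
    have hsemi (f : χ ⟶ V ⊗ W) (g : G) :
        TensorProduct.map (V.ρ g) (W.ρ g) (f.hom.hom.hom e) = a g • f.hom.hom.hom e := by
      rw [← FDRep.tensor_ρ, ← FDRep.hom_ρ_apply, ← ha, map_smul]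
    by_cases h : ∃ f : χ ⟶ V ⊗ W, f ≠ 0
    · obtain ⟨f, hf⟩ := h
      refine finrank_le_one f fun f' ↦ ?_
      obtain ⟨c, hc⟩ := Representation.exists_smul_eq_of_semiinvariant (hsemi f') (hsemi f)
        (fun h₀ ↦ hf (hom_ext h₀))
      exact ⟨c, hom_ext hc⟩
    · push Not at h
      exact finrank_le_one 0 fun f ↦ ⟨0, by rw [h f, smul_zero]⟩
  refine ⟨hle, fun f₁ f₂ hli ↦ ?_⟩
  have := hli.fintype_card_le_finrank
  rw [Fintype.card_fin] at this
  omega
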